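/- arXiv:1206.3152 — 3 statements merged into one kernel-verified Lean document; each statement's English description precedes it below -/
import Mathlib

section
/- (i) For every constant K > 0 there exist constants C > 0 and d₀ such that for all integers d ≥ d₀ and every A ⊆ E with |A| ≤ d^K, one has d·|A| ≤ C·|N(A)|. (ii) For every integer d ≥ 1 and every A ⊆ E with |A| ≤ d/2, one has |N(A)| ≥ d·|A| − 2·|A|·(|A| − 1). -/
/-- Two vertices of the Hamming cube `{0,1}^d` are adjacent iff they differ in
exactly one coordinate. -/
def cubeAdj (d : ℕ) (u v : Fin d → Bool) : Prop :=
  (Finset.univ.filter fun i => u i ≠ v i).card = 1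

/-- The even vertices of the Hamming cube. -/
def evenV (d : ℕ) : Set (Fin d → Bool) :=
  {v | Even (Finset.univ.filter fun i => v i = true).card}

/-- The odd vertices of the Hamming cube. -/
def oddV (d : ℕ) : Set (Fin d → Bool) :=
  {v | ¬ Even (Finset.univ.filter fun i => v i = true).card}

/-- `nbhd d A` is the set of vertices having at least one neighbour in `A`. -/
def nbhd (d : ℕ) (A : Set (Fin d → Bool)) : Set (Fin d → Bool) :=
  {v | ∃ u ∈ A, cubeAdj d u v}

/-- `bset d A` is the set of vertices all of whose neighbours lie in `A`. -/
def bset (d : ℕ) (A : Set (Fin d → Bool)) : Set (Fin d → Bool) :=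
  {v | ∀ u, cubeAdj d v u → u ∈ A}

open Finset in
/-- A bipartite graph with more than `p * #s + q * #t` edges has a nonempty subgraph whose minimum
degrees on the two sides are at least `p` and `q`. -/
theorem exists_subsets_le_card_bipartite {α β : Type*} [DecidableEq α] [DecidableEq β]
    (r : α → β → Prop) [∀ a, DecidablePred (r a)] [∀ b, DecidablePred fun a => r a b]
    (p q : ℕ) (s : Finset α) (t : Finset β)
    (h : p * #s + q * #t < ∑ a ∈ s, #(t.bipartiteAbove r a)) :
    ∃ s' ⊆ s, ∃ t' ⊆ t, s'.Nonempty ∧ (∀ a ∈ s', p ≤ #(t'.bipartiteAbove r a)) ∧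
      ∀ b ∈ t', q ≤ #(s'.bipartiteBelow r b) := by
  induction hn : #s + #t using Nat.strong_induction_on generalizing s t with
  | _ n ih =>
  by_cases hs : ∀ a ∈ s, p ≤ #(t.bipartiteAbove r a)
  · by_cases ht : ∀ b ∈ t, q ≤ #(s.bipartiteBelow r b)
    · refine ⟨s, Subset.rfl, t, Subset.rfl, ?_, hs, ht⟩
      rw [nonempty_iff_ne_empty]
      rintro rfl
      simp at h
    · push Not at ht
      obtain ⟨b, hb, hlt⟩ := ht
      have hcard := card_erase_add_one hb
      obtain ⟨s', hs', t', ht', H⟩ := ih (#s + #(t.erase b)) (by omega) s (t.erase b) (by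
        rw [sum_card_bipartiteAbove_eq_sum_card_bipartiteBelow] at h ⊢
        rw [← add_sum_erase _ _ hb, ← hcard] at h
        linarith) rfl
      exact ⟨s', hs', t', ht'.trans (erase_subset _ _), H⟩
  · push Not at hs
    obtain ⟨a, ha, hlt⟩ := hs
    have hcard := card_erase_add_one ha
    obtain ⟨s', hs', t', ht', H⟩ := ih (#(s.erase a) + #t) (by omega) (s.erase a) t (by
      rw [← add_sum_erase _ _ ha, ← hcard] at h
      linarith) rfl
    exact ⟨s', hs'.trans (erase_subset _ _), t', ht', H⟩

namespace HammingCube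

open Finset

variable {d : ℕ}

/-- Flip the `i`-th coordinate of `u`. -/
def flip (u : Fin d → Bool) (i : Fin d) : Fin d → Bool :=
  Function.update u i (!u i)

theorem flip_injective (u : Fin d → Bool) : Function.Injective (flip u) := by
  intro i j hij
  by_contra hne
  have := congrFun hij i
  simp [flip, hne] at this

theorem hammingDist_flip_of_ne {a u : Fin d → Bool} {i : Fin d} (h : a i ≠ u i) :
    hammingDist a (flip u i) + 1 = hammingDist a u := by
  have hi : i ∈ univ.filter fun j => a j ≠ u j := by simpa using h
  unfold hammingDist
  rw [← card_erase_add_one hi]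
  congr 2
  ext j
  by_cases hj : j = i
  · subst hj
    cases ha : a j <;> cases hu : u j <;> simp_all [flip]
  · rw [mem_filter, mem_erase, mem_filter]
    simp [flip, hj]

theorem hammingDist_flip_of_eq {a u : Fin d → Bool} {i : Fin d} (h : a i = u i) :
    hammingDist a (flip u i) = hammingDist a u + 1 := by
  have hne : a i ≠ flip u i i := by simp [flip, h]
  rw [← hammingDist_flip_of_ne hne]
  simp [flip]

theorem hammingDist_eq_one_iff {u v : Fin d → Bool} :
    hammingDist u v = 1 ↔ ∃ i, flip u i = v := by
  constructor
  · intro h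
    obtain ⟨i, hi⟩ := card_eq_one.mp h
    refine ⟨i, funext fun j => ?_⟩
    have hj : u j ≠ v j ↔ j = i := by
      simpa using congrArg (j ∈ ·) hi
    by_cases hji : j = i
    · subst hji
      have := hj.mpr rfl
      cases hu : u j <;> cases hv : v j <;> simp_all [flip]
    · have : u j = v j := by tauto
      simp [flip, hji, this]
  · rintro ⟨i, rfl⟩
    simpa using hammingDist_flip_of_eq (a := u) (u := u) (i := i) rfl

theorem hammingDist_of_adj (a : Fin d → Bool) {u v : Fin d → Bool} (h : hammingDist u v = 1) :
    hammingDist a v + 1 = hammingDist a u ∨ hammingDist a v = hammingDist a u + 1 := by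
  obtain ⟨i, rfl⟩ := hammingDist_eq_one_iff.mp h
  by_cases hi : a i = u i
  · exact Or.inr (hammingDist_flip_of_eq hi)
  · exact Or.inl (hammingDist_flip_of_ne hi)

/-- The neighbours of `u` in the Hamming cube. -/
def neighbors (u : Fin d → Bool) : Finset (Fin d → Bool) :=
  univ.filter fun v => hammingDist u v = 1

theorem mem_neighbors {u v : Fin d → Bool} : v ∈ neighbors u ↔ hammingDist u v = 1 := by
  simp [neighbors]

theorem card_neighbors (u : Fin d → Bool) : #(neighbors u) = d := by
  have : neighbors u = univ.image (flip u) := by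
    ext v
    simp [mem_neighbors, hammingDist_eq_one_iff]
  rw [this, card_image_of_injective _ (flip_injective u)]
  simp

theorem card_neighbors_closer_le (a u : Fin d → Bool) :
    #((neighbors u).filter fun v => hammingDist a v + 1 = hammingDist a u) ≤ hammingDist a u := by
  calc _ ≤ #((univ.filter fun i => a i ≠ u i).image (flip u)) := by
        refine card_le_card fun v hv => ?_
        obtain ⟨hv, hd⟩ := mem_filter.mp hv
        obtain ⟨i, rfl⟩ := hammingDist_eq_one_iff.mp (mem_neighbors.mp hv)
        refine mem_image_of_mem _ (mem_filter.mpr ⟨mem_univ _, fun hi => ?_⟩)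
        rw [hammingDist_flip_of_eq hi] at hd
        omega
    _ ≤ _ := card_image_le

theorem card_neighbors_inter_le {u v : Fin d → Bool} (h : u ≠ v) :
    #(neighbors u ∩ neighbors v) ≤ 2 := by
  rcases (neighbors u ∩ neighbors v).eq_empty_or_nonempty with he | ⟨w, hw⟩
  · simp [he]
  simp only [mem_inter, mem_neighbors] at hw
  have hpos := hammingDist_pos.mpr h
  have huv : hammingDist u v = 2 := by
    have := hammingDist_of_adj u hw.2
    omega
  rw [← huv]
  refine (card_le_card fun x hx => ?_).trans (card_neighbors_closer_le u v)
  simp only [mem_inter, mem_neighbors] at hx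
  simp [mem_neighbors, hx, huv]

theorem nbhd_coe (A : Finset (Fin d → Bool)) :
    nbhd d A = (A.biUnion neighbors : Finset (Fin d → Bool)) := by
  ext v
  simp [nbhd, cubeAdj, mem_neighbors, hammingDist]

theorem le_card_biUnion_neighbors (A : Finset (Fin d → Bool)) :
    (d : ℝ) * #A - 2 * #A * ((#A : ℝ) - 1) ≤ #(A.biUnion neighbors) := by
  induction A using Finset.induction_on with
  | empty => simp
  | insert a A ha ih =>
    have hinter : #(neighbors a ∩ A.biUnion neighbors) ≤ #A * 2 := by
      rw [inter_biUnion]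
      refine card_biUnion_le_card_mul _ _ _ fun u hu => card_neighbors_inter_le ?_
      rintro rfl
      exact ha hu
    have hunion := card_union_add_card_inter (neighbors a) (A.biUnion neighbors)
    rw [card_neighbors] at hunion
    rw [biUnion_insert, card_insert_of_notMem ha]
    have h₁ : (#(neighbors a ∩ A.biUnion neighbors) : ℝ) ≤ #A * 2 := by exact_mod_cast hinter
    have h₂ : (#(neighbors a ∪ A.biUnion neighbors) : ℝ) + #(neighbors a ∩ A.biUnion neighbors)
        = d + #(A.biUnion neighbors) := by exact_mod_cast hunion
    push_cast
    linarith

/-- If every vertex of `S` lies at distance `n` from `a` and has at least `q + n` neighbours in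
`T`, then `T` has many vertices at distance `n + 1` from `a`. -/
theorem card_mul_le_card_filter_hammingDist (a : Fin d → Bool) (n q : ℕ)
    (S T : Finset (Fin d → Bool)) (hS : ∀ u ∈ S, hammingDist a u = n)
    (hdeg : ∀ u ∈ S, q + n ≤ #(T.filter fun v => hammingDist u v = 1)) :
    #S * q ≤ #(T.filter fun v => hammingDist a v = n + 1) * (n + 1) := by
  refine card_mul_le_card_mul (fun u v => hammingDist u v = 1) (fun u hu => ?_) (fun v hv => ?_)
  · have hle : #(T.filter fun v => hammingDist u v = 1) ≤
        #((neighbors u).filter fun v => hammingDist a v + 1 = hammingDist a u) +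
        #(bipartiteAbove (fun u v => hammingDist u v = 1)
          (T.filter fun v => hammingDist a v = n + 1) u) := by
      refine (card_le_card fun v hv => ?_).trans (card_union_le _ _)
      obtain ⟨hvT, huv⟩ := mem_filter.mp hv
      rcases hammingDist_of_adj a huv with h | h
      · exact mem_union_left _ (mem_filter.mpr ⟨mem_neighbors.mpr huv, h⟩)
      · refine mem_union_right _ ?_
        simp [bipartiteAbove, hvT, huv, h, hS u hu]
    have := card_neighbors_closer_le a u
    have := hdeg u hu
    have := hS u hu
    omega
  · have hvn := (mem_filter.mp hv).2
    rw [← hvn]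
    refine (card_le_card fun u hu => ?_).trans (card_neighbors_closer_le a v)
    obtain ⟨huS, huv⟩ := mem_filter.mp hu
    rw [hammingDist_comm] at huv
    simp [mem_neighbors, huv, hvn, hS u huS]

theorem pow_le_factorial_mul_card (p k : ℕ) (A B : Finset (Fin d → Bool)) (hA : A.Nonempty)
    (hAB : ∀ u ∈ A, p ≤ #(B.filter fun v => hammingDist u v = 1))
    (hBA : ∀ v ∈ B, 2 * k ≤ #(A.filter fun u => hammingDist v u = 1)) (hp : 2 * k ≤ p) :
    (p - 2 * k) ^ k ≤ (2 * k).factorial * #A := by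
  obtain ⟨a, ha⟩ := hA
  have key : ∀ m ≤ k, (p - 2 * k) ^ m ≤
      (2 * m).factorial * #(A.filter fun u => hammingDist a u = 2 * m) := by
    intro m
    induction m with
    | zero =>
      intro _
      have : a ∈ A.filter fun u => hammingDist a u = 2 * 0 := by simp [ha]
      simpa using card_pos.mpr ⟨a, this⟩
    | succ m ih =>
      intro hm
      have h₁ := card_mul_le_card_filter_hammingDist a (2 * m) (p - 2 * k)
        (A.filter fun u => hammingDist a u = 2 * m) B (fun u hu => (mem_filter.mp hu).2)
        (fun u hu => le_trans (by omega) (hAB u (mem_filter.mp hu).1))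
      have h₂ := card_mul_le_card_filter_hammingDist a (2 * m + 1) 1
        (B.filter fun u => hammingDist a u = 2 * m + 1) A (fun u hu => (mem_filter.mp hu).2)
        (fun u hu => le_trans (by omega) (hBA u (mem_filter.mp hu).1))
      have hfac : (2 * (m + 1)).factorial = (2 * m + 2) * ((2 * m + 1) * (2 * m).factorial) := by
        rw [show 2 * (m + 1) = 2 * m + 1 + 1 by ring, Nat.factorial_succ, Nat.factorial_succ]
      rw [hfac, pow_succ]
      rw [mul_one] at h₂
      calc (p - 2 * k) ^ m * (p - 2 * k)
          ≤ (2 * m).factorial * #(A.filter fun u => hammingDist a u = 2 * m) * (p - 2 * k) :=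
            Nat.mul_le_mul_right _ (ih (by omega))
        _ = (2 * m).factorial *
              (#(A.filter fun u => hammingDist a u = 2 * m) * (p - 2 * k)) := by ring
        _ ≤ (2 * m).factorial *
              (#(A.filter fun u => hammingDist a u = 2 * m + 1 + 1) * (2 * m + 1 + 1) *
                (2 * m + 1)) :=
            Nat.mul_le_mul_left _ (h₁.trans (Nat.mul_le_mul_right _ h₂))
        _ = _ := by
            rw [show 2 * (m + 1) = 2 * m + 1 + 1 by ring]
            ring
  exact (key k le_rfl).trans (Nat.mul_le_mul_left _ (card_filter_le _ _))

/-- A set of vertices with small neighbourhood is large. -/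
theorem pow_le_mul_card (k : ℕ) (hd : 8 * k + 2 ≤ d) (A : Finset (Fin d → Bool))
    (h : 4 * k * #(A.biUnion neighbors) < d * #A) :
    d ^ k ≤ 4 ^ k * (2 * k).factorial * #A := by
  have hedges : ∑ u ∈ A, #((A.biUnion neighbors).bipartiteAbove
      (fun u v => hammingDist u v = 1) u) = d * #A := by
    rw [mul_comm, ← smul_eq_mul]
    refine sum_const_nat fun u hu => ?_
    refine Eq.trans (congrArg card ?_) (card_neighbors u)
    ext v
    simp only [mem_bipartiteAbove, mem_biUnion, mem_neighbors, and_iff_right_iff_imp]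
    exact fun hv => ⟨u, hu, hv⟩
  obtain ⟨A', hA', B', -, hne, hAB, hBA⟩ := exists_subsets_le_card_bipartite
    (fun u v : Fin d → Bool => hammingDist u v = 1) (d / 2) (2 * k) A (A.biUnion neighbors) (by
      rw [hedges]
      have : 2 * (d / 2) * #A ≤ d * #A := Nat.mul_le_mul_right _ (Nat.mul_div_le d 2)
      linarith)
  have hpow := pow_le_factorial_mul_card (d / 2) k A' B' hne hAB
    (fun v hv => by
      simpa only [bipartiteBelow, hammingDist_comm v] using hBA v hv) (by omega)
  calc d ^ k ≤ (4 * (d / 2 - 2 * k)) ^ k := Nat.pow_le_pow_left (by omega) k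
    _ = 4 ^ k * (d / 2 - 2 * k) ^ k := mul_pow _ _ _
    _ ≤ 4 ^ k * ((2 * k).factorial * #A) :=
        Nat.mul_le_mul_left _ (hpow.trans (Nat.mul_le_mul_left _ (card_le_card hA')))
    _ = _ := by ring

end HammingCube

theorem isoperimetry_very_small_sets :
    (∀ K : ℝ, 0 < K → ∃ C > (0:ℝ), ∃ d₀ : ℕ, ∀ d : ℕ, d₀ ≤ d →
      ∀ A : Set (Fin d → Bool), A ⊆ evenV d → (A.ncard : ℝ) ≤ (d:ℝ) ^ K →
        (d:ℝ) * A.ncard ≤ C * (nbhd d A).ncard) ∧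
    (∀ d : ℕ, 1 ≤ d → ∀ A : Set (Fin d → Bool), A ⊆ evenV d →
      (A.ncard : ℝ) ≤ (d:ℝ) / 2 →
        (d:ℝ) * A.ncard - 2 * A.ncard * ((A.ncard : ℝ) - 1) ≤
          ((nbhd d A).ncard : ℝ)) := by
  constructor
  · intro K hK
    obtain ⟨k, hk⟩ := exists_nat_ge (K + 1)
    have hkpos : (0 : ℝ) < k := by linarith
    refine ⟨4 * k, by positivity, 8 * k + 2 + 4 ^ k * (2 * k).factorial, fun d hd A _ hA => ?_⟩
    lift A to Finset (Fin d → Bool) using A.toFinite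
    rw [HammingCube.nbhd_coe, Set.ncard_coe_finset, Set.ncard_coe_finset]
    rw [Set.ncard_coe_finset] at hA
    by_contra! hlt
    have hpow := HammingCube.pow_le_mul_card k (by omega) A (by exact_mod_cast hlt)
    have hpow' : (d : ℝ) ^ k ≤ (4 ^ k * (2 * k).factorial : ℕ) * (A.card : ℝ) := by
      exact_mod_cast hpow
    have hd1 : (1 : ℝ) ≤ d := by exact_mod_cast (by omega : 1 ≤ d)
    have hdK : (0 : ℝ) < (d : ℝ) ^ K := by positivity
    have hdk : (d : ℝ) ^ K * d ≤ (d : ℝ) ^ k := by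
      rw [← Real.rpow_add_one (by positivity), ← Real.rpow_natCast]
      exact Real.rpow_le_rpow_of_exponent_le hd1 hk
    have hlarge : ((4 ^ k * (2 * k).factorial : ℕ) : ℝ) < d := by
      exact_mod_cast (by omega : 4 ^ k * (2 * k).factorial < d)
    have hle : ((4 ^ k * (2 * k).factorial : ℕ) : ℝ) * (A.card : ℝ) ≤
        ((4 ^ k * (2 * k).factorial : ℕ) : ℝ) * (d : ℝ) ^ K :=
      mul_le_mul_of_nonneg_left hA (Nat.cast_nonneg _)
    nlinarith [mul_lt_mul_of_pos_right hlarge hdK]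
  · intro d _ A _ _
    lift A to Finset (Fin d → Bool) using A.toFinite
    rw [HammingCube.nbhd_coe, Set.ncard_coe_finset, Set.ncard_coe_finset]
    exact HammingCube.le_card_biUnion_neighbors A
end

section
/- For every real number α with 1 < α < 2 there exist constants ε > 0 and d₀ such that the following holds for all integers d ≥ d₀, all a ≤ α^d and all g, b, h. Let (F,S,P,Q) be any quadruple with F, Q ⊆ O and S, P ⊆ E such that every u ∈ S has more than d − √d neighbours in F, every v ∈ O \ F has more than d − √d neighbours in E \ S, every u ∈ Q has more than d − √d neighbours in P, and every v ∈ E \ P has more than d − √d neighbours in O \ Q. Then the number of A ∈ H(a,g,b,h) satisfying F ⊆ N(A), S ⊇ A, P ⊆ N(B(A)) and Q ⊇ B(A) is at most 2^{g − b − ε·g/log₂ d}. -/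
/-- Graph (Hamming) distance in the cube `Q_d`. -/
def hamDist {d : ℕ} (u v : Fin d → Bool) : ℕ :=
  (Finset.univ.filter fun i => u i ≠ v i).card

/-- `A` is 2-linked: any two of its vertices are connected by a chain of steps,
inside `A`, of Hamming distance at most 2 each. -/
def twoLinked {d : ℕ} (A : Set (Fin d → Bool)) : Prop :=
  ∀ u ∈ A, ∀ v ∈ A, Relation.ReflTransGen (fun x y => y ∈ A ∧ hamDist x y ≤ 2) u v

/-- The family of 2-linked subsets `A ⊆ E` with `|A| = a`, `|N(A)| = g`,
`|B(A)| = b` and `|N(B(A))| = h`. -/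
def Hfam (d a g b h : ℕ) : Set (Set (Fin d → Bool)) :=
  {A | A ⊆ evenV d ∧ twoLinked A ∧ A.ncard = a ∧ (nbhd d A).ncard = g ∧
       (bset d A).ncard = b ∧ (nbhd d (bset d A)).ncard = h}

/-- The number of neighbours of `u` lying in `T`. -/
noncomputable def ndeg (d : ℕ) (u : Fin d → Bool) (T : Set (Fin d → Bool)) : ℕ :=
  ({w ∈ T | cubeAdj d u w} : Set _).ncard

/-- Negate the `i`-th coordinate of a vertex of the cube. -/
def flipAt {d : ℕ} (i : Fin d) (u : Fin d → Bool) : Fin d → Bool :=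
  Function.update u i (!u i)

lemma flipAt_same {d : ℕ} (i : Fin d) (u : Fin d → Bool) : flipAt i u i = !u i := by
  simp [flipAt]

lemma flipAt_of_ne {d : ℕ} {i j : Fin d} (h : j ≠ i) (u : Fin d → Bool) :
    flipAt i u j = u j := by
  simp [flipAt, h]

lemma flipAt_flipAt {d : ℕ} (i : Fin d) (u : Fin d → Bool) : flipAt i (flipAt i u) = u := by
  simp [flipAt]

lemma flipAt_injective {d : ℕ} (i : Fin d) :
    Function.Injective (flipAt i : (Fin d → Bool) → (Fin d → Bool)) :=
  Function.LeftInverse.injective (flipAt_flipAt i)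

lemma cubeAdj_iff {d : ℕ} {u v : Fin d → Bool} : cubeAdj d u v ↔ ∃ i, v = flipAt i u := by
  unfold cubeAdj
  rw [Finset.card_eq_one]
  constructor
  · rintro ⟨i, hi⟩
    refine ⟨i, funext fun j => ?_⟩
    have hj := Finset.ext_iff.1 hi j
    simp only [Finset.mem_filter, Finset.mem_univ, true_and, Finset.mem_singleton] at hj
    by_cases hji : j = i
    · subst hji
      rw [flipAt_same]
      exact Bool.eq_not.2 (hj.2 rfl).symm
    · rw [flipAt_of_ne hji]
      exact (not_not.1 (mt hj.1 hji)).symm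
  · rintro ⟨i, rfl⟩
    refine ⟨i, Finset.ext fun j => ?_⟩
    simp only [Finset.mem_filter, Finset.mem_univ, true_and, Finset.mem_singleton]
    by_cases hji : j = i
    · subst hji
      simp [flipAt_same]
    · simp [flipAt_of_ne hji, hji]

lemma cubeAdj_flipAt {d : ℕ} (i : Fin d) (u : Fin d → Bool) : cubeAdj d u (flipAt i u) :=
  cubeAdj_iff.2 ⟨i, rfl⟩

lemma cubeAdj_symm {d : ℕ} {u v : Fin d → Bool} (h : cubeAdj d u v) : cubeAdj d v u := by
  obtain ⟨i, rfl⟩ := cubeAdj_iff.1 h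
  exact cubeAdj_iff.2 ⟨i, (flipAt_flipAt i u).symm⟩

lemma even_flipAt_iff {d : ℕ} (i : Fin d) (u : Fin d → Bool) :
    flipAt i u ∈ evenV d ↔ u ∉ evenV d := by
  have key : ∀ w : Fin d → Bool, w i = false → (flipAt i w ∈ evenV d ↔ w ∉ evenV d) := by
    intro w hw
    have : (Finset.univ.filter fun j => flipAt i w j = true)
        = insert i (Finset.univ.filter fun j => w j = true) := by
      ext j
      by_cases hji : j = i
      · subst hji
        simp [flipAt_same, hw]
      · simp [flipAt_of_ne hji, hji]
    simp only [evenV, Set.mem_ofPred_eq]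
    rw [this, Finset.card_insert_of_notMem (by simp [hw]), Nat.even_add_one]
  cases hu : u i with
  | false => exact key u hu
  | true =>
    have h := key (flipAt i u) (by simp [flipAt_same, hu])
    rw [flipAt_flipAt] at h
    tauto

lemma nbhd_subset_oddV {d : ℕ} {A : Set (Fin d → Bool)} (hA : A ⊆ evenV d) :
    nbhd d A ⊆ oddV d := by
  rintro v ⟨u, hu, huv⟩
  obtain ⟨i, rfl⟩ := cubeAdj_iff.1 huv
  intro h
  exact (even_flipAt_iff i u).1 h (hA hu)

lemma nbhd_bset_subset {d : ℕ} (A : Set (Fin d → Bool)) : nbhd d (bset d A) ⊆ A := by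
  rintro v ⟨u, hu, huv⟩
  exact hu v huv

lemma subset_bset_nbhd {d : ℕ} (A : Set (Fin d → Bool)) : A ⊆ bset d (nbhd d A) :=
  fun u hu _ huv => ⟨u, hu, huv⟩

lemma disjoint_bset_nbhd {d : ℕ} (hd : 0 < d) {A : Set (Fin d → Bool)} (hA : A ⊆ evenV d) :
    Disjoint (bset d (nbhd d A)) (nbhd d A) := by
  rw [Set.disjoint_left]
  intro u hu hu'
  have h := nbhd_subset_oddV hA (hu _ (cubeAdj_flipAt ⟨0, hd⟩ u))
  exact h ((even_flipAt_iff _ u).2 (nbhd_subset_oddV hA hu'))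

open Classical in
lemma ndeg_eq_card {d : ℕ} (u : Fin d → Bool) (T : Set (Fin d → Bool)) :
    ndeg d u T = (Finset.univ.filter fun i => flipAt i u ∈ T).card := by
  have hinj : Function.Injective fun i => flipAt i u := by
    intro i j hij
    by_contra hne
    have := congrFun hij i
    simp only [flipAt_same, flipAt_of_ne hne] at this
    simp at this
  have : {w ∈ T | cubeAdj d u w}
      = ((Finset.univ.filter fun i => flipAt i u ∈ T).image fun i => flipAt i u :
          Finset (Fin d → Bool)) := by
    ext w
    simp only [Set.mem_ofPred_eq, Finset.coe_image, Finset.coe_filter, Finset.mem_univ, true_and,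
      Set.mem_image, cubeAdj_iff]
    constructor
    · rintro ⟨hw, i, rfl⟩
      exact ⟨i, hw, rfl⟩
    · rintro ⟨i, hi, rfl⟩
      exact ⟨hi, i, rfl⟩
  rw [ndeg, this, Set.ncard_coe_finset, Finset.card_image_of_injective _ hinj]

open Classical in
lemma ndeg_of_forall {d : ℕ} {u : Fin d → Bool} {T : Set (Fin d → Bool)}
    (h : ∀ v, cubeAdj d u v → v ∈ T) : ndeg d u T = d := by
  rw [ndeg_eq_card, Finset.filter_true_of_mem fun i _ => h _ (cubeAdj_flipAt i u)]
  simp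

lemma one_le_ndeg {d : ℕ} {u v : Fin d → Bool} {T : Set (Fin d → Bool)}
    (h : cubeAdj d u v) (hv : v ∈ T) : 1 ≤ ndeg d u T :=
  (Set.ncard_pos (Set.toFinite _)).2 ⟨v, hv, h⟩

open Classical in
lemma sum_ndeg_comm {d : ℕ} (S : Finset (Fin d → Bool)) (T : Set (Fin d → Bool)) :
    ∑ u ∈ S, ndeg d u T = ∑ i : Fin d, (S.filter fun u => flipAt i u ∈ T).card := by
  simp only [ndeg_eq_card, Finset.card_filter]
  exact Finset.sum_comm

open Classical in
/-- Double counting of edges: a set all of whose vertices have at least `k` neighbours in `F`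
has size at most `d |F| / k`. -/
lemma mul_ncard_le {d : ℕ} {S F : Set (Fin d → Bool)} {k : ℝ}
    (h : ∀ u ∈ S, k ≤ ndeg d u F) : k * S.ncard ≤ d * F.ncard := by
  have h1 : k * S.ncard ≤ ∑ u ∈ S.toFinset, (ndeg d u F : ℝ) := by
    rw [Set.ncard_eq_toFinset_card', mul_comm, ← nsmul_eq_mul]
    exact Finset.card_nsmul_le_sum _ _ _ fun u hu => h u (by simpa using hu)
  have h2 : ∑ u ∈ S.toFinset, ndeg d u F ≤ d * F.ncard := by
    rw [sum_ndeg_comm, Set.ncard_eq_toFinset_card' F]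
    calc _ ≤ ∑ _i : Fin d, F.toFinset.card := by
          refine Finset.sum_le_sum fun i _ => ?_
          refine Finset.card_le_card_of_injOn (flipAt i) ?_ (flipAt_injective i).injOn
          intro u hu
          simp only [Finset.coe_filter, Set.mem_ofPred_eq] at hu
          simpa using hu.2
      _ = _ := by simp
  calc _ ≤ _ := h1
    _ ≤ _ := by exact_mod_cast h2

lemma ncard_nbhd_le {d : ℕ} (A : Set (Fin d → Bool)) :
    ((nbhd d A).ncard : ℝ) ≤ d * A.ncard := by
  have := mul_ncard_le (S := nbhd d A) (F := A) (k := 1) (by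
    rintro v ⟨u, hu, huv⟩
    exact_mod_cast one_le_ndeg (cubeAdj_symm huv) hu)
  simpa using this

lemma ncard_bset_le {d : ℕ} (hd : 0 < d) (A : Set (Fin d → Bool)) :
    (bset d A).ncard ≤ A.ncard := by
  have := mul_ncard_le (S := bset d A) (F := A) (k := d) (by
    intro u hu
    rw [ndeg_of_forall hu])
  have hd' : (0 : ℝ) < d := by exact_mod_cast hd
  exact_mod_cast le_of_mul_le_mul_left this hd'

lemma ncard_le_ncard_nbhd {d : ℕ} (hd : 0 < d) (A : Set (Fin d → Bool)) :
    A.ncard ≤ (nbhd d A).ncard :=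
  (Set.ncard_le_ncard (subset_bset_nbhd A) (Set.toFinite _)).trans (ncard_bset_le hd _)

lemma mul_log_add_mul_log_le {x y : ℝ} (hx : 0 ≤ x) (hxy : x ≤ y) :
    x * Real.log x + y * Real.log y + 2 * x * Real.log 2 ≤ (x + y) * Real.log (x + y) := by
  rcases hx.eq_or_lt with rfl | hx
  · simp
  have hy : 0 < y := hx.trans_le hxy
  have hs : 0 < x + y := by positivity
  set p := x / (x + y) with hp
  have hp0 : 0 ≤ p := by positivity
  have hp1 : p ≤ 1 / 2 := by
    rw [hp, div_le_iff₀ hs]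
    linarith
  have h0 : (0 : ℝ) ∈ Set.Icc (0 : ℝ) 1 := by simp
  have h2 : (2⁻¹ : ℝ) ∈ Set.Icc (0 : ℝ) 1 := by constructor <;> norm_num
  have ha : 0 ≤ 1 - 2 * p := by linarith
  have hb : 0 ≤ 2 * p := by linarith
  have hc := Real.strictConcave_binEntropy.concaveOn.2 h0 h2 ha hb (by ring)
  have hq : 1 - p = y / (x + y) := by
    rw [hp]
    field_simp
    ring
  have he : (1 - 2 * p) • (0 : ℝ) + (2 * p) • (2⁻¹ : ℝ) = p := by
    simp only [smul_eq_mul]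
    ring
  rw [he, Real.binEntropy_zero, Real.binEntropy_two_inv, Real.binEntropy, hq, hp] at hc
  rw [inv_div, inv_div, Real.log_div hs.ne' hx.ne', Real.log_div hs.ne' hy.ne'] at hc
  simp only [smul_eq_mul, mul_zero, zero_add] at hc
  have h := mul_le_mul_of_nonneg_left hc hs.le
  have e1 : (x + y) * (2 * (x / (x + y)) * Real.log 2) = 2 * x * Real.log 2 := by
    field_simp
  have e2 : (x + y) * (x / (x + y) * (Real.log (x + y) - Real.log x)
      + y / (x + y) * (Real.log (x + y) - Real.log y))
      = x * (Real.log (x + y) - Real.log x) + y * (Real.log (x + y) - Real.log y) := by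
    field_simp
  rw [e1, e2] at h
  linarith

lemma mul_log_add_mul_log_add_min_le {x y : ℝ} (hx : 0 ≤ x) (hy : 0 ≤ y) :
    x * Real.log x + y * Real.log y + 2 * min x y * Real.log 2
      ≤ (x + y) * Real.log (x + y) := by
  rcases le_total x y with h | h
  · rw [min_eq_left h]
    exact mul_log_add_mul_log_le hx h
  · rw [min_eq_right h, add_comm (x * _), add_comm x]
    exact mul_log_add_mul_log_le hy h

/-- Edge-isoperimetric inequality in the directions `I`: twice the number of edges in `X`
is at most `|X| log₂ |X|`. -/
lemma sum_card_flipAt_le {d : ℕ} (I : Finset (Fin d)) (X : Finset (Fin d → Bool)) :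
    ((∑ i ∈ I, (X.filter fun u => flipAt i u ∈ X).card : ℕ) : ℝ) * Real.log 2
      ≤ X.card * Real.log X.card := by
  induction I using Finset.induction_on generalizing X with
  | empty =>
    simp only [Finset.sum_empty, Nat.cast_zero, zero_mul]
    exact mul_nonneg (Nat.cast_nonneg _) (Real.log_natCast_nonneg _)
  | insert j I hj ih =>
    set Y : Bool → Finset (Fin d → Bool) := fun c => X.filter fun u => u j = c with hY
    have hcard : X.card = (Y true).card + (Y false).card := by
      rw [← Finset.card_filter_add_card_filter_not (fun u : Fin d → Bool => u j = true)]
      simp [hY]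
    have hI : ∀ i ∈ I, (X.filter fun u => flipAt i u ∈ X).card
        = ((Y true).filter fun u => flipAt i u ∈ Y true).card
          + ((Y false).filter fun u => flipAt i u ∈ Y false).card := by
      intro i hi
      have hji : j ≠ i := fun h => hj (h ▸ hi)
      rw [← Finset.card_filter_add_card_filter_not (fun u : Fin d → Bool => u j = true)]
      congr 2
      · ext u
        simp only [hY, Finset.mem_filter, flipAt_of_ne hji]
        tauto
      · ext u
        simp only [hY, Finset.mem_filter, flipAt_of_ne hji, Bool.not_eq_true]
        tauto
    have hflip : ∀ c, ((X.filter fun u => flipAt j u ∈ X).filter fun u => u j = c).card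
        ≤ min (Y true).card (Y false).card := by
      intro c
      have h1 : ((X.filter fun u => flipAt j u ∈ X).filter fun u => u j = c).card
          ≤ (Y c).card := by
        refine Finset.card_le_card fun u hu => ?_
        simp only [hY, Finset.mem_filter] at hu ⊢
        tauto
      have h2 : ((X.filter fun u => flipAt j u ∈ X).filter fun u => u j = c).card
          ≤ (Y !c).card := by
        refine Finset.card_le_card_of_injOn (flipAt j) ?_ (flipAt_injective j).injOn
        intro u hu
        simp only [Finset.coe_filter, Finset.mem_filter, Set.mem_ofPred_eq] at hu
        simp [hY, flipAt_same, hu.1.2, hu.2]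
      cases c
      · exact le_min h2 h1
      · exact le_min h1 h2
    have hj' : (X.filter fun u => flipAt j u ∈ X).card
        ≤ 2 * min (Y true).card (Y false).card := by
      rw [← Finset.card_filter_add_card_filter_not (fun u : Fin d → Bool => u j = true)]
      have h1 := hflip true
      have h2 := hflip false
      simp only [Bool.not_eq_true]
      omega
    rw [Finset.sum_insert hj, Finset.sum_congr rfl hI, Finset.sum_add_distrib]
    have hmin := mul_log_add_mul_log_add_min_le (x := (Y true).card) (y := (Y false).card)
      (Nat.cast_nonneg _) (Nat.cast_nonneg _)
    have h1 := ih (Y true)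
    have h2 := ih (Y false)
    have hlog : 0 ≤ Real.log 2 := Real.log_nonneg (by norm_num)
    have h3 : ((X.filter fun u => flipAt j u ∈ X).card : ℝ) * Real.log 2
        ≤ 2 * min ((Y true).card : ℝ) (Y false).card * Real.log 2 := by
      refine mul_le_mul_of_nonneg_right ?_ hlog
      exact_mod_cast hj'
    rw [hcard]
    push_cast at h1 h2 hmin ⊢
    linarith

open Classical in
lemma two_mul_ncard_bset_nbhd_le {d : ℕ} (hd : 0 < d) {A : Set (Fin d → Bool)}
    (hA : A ⊆ evenV d) {C G : ℕ} (hC : (bset d (nbhd d A)).ncard = C)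
    (hG : (nbhd d A).ncard = G) :
    2 * (d : ℝ) * C ≤ (C + G) * Real.logb 2 (C + G) := by
  set X := (bset d (nbhd d A)).toFinset with hX
  set Y := (nbhd d A).toFinset with hY
  have hXC : X.card = C := by rw [← hC, Set.ncard_eq_toFinset_card']
  have hYG : Y.card = G := by rw [← hG, Set.ncard_eq_toFinset_card']
  have hdisj : Disjoint X Y := by
    rw [Set.disjoint_toFinset]
    exact disjoint_bset_nbhd hd hA
  have hflip : ∀ i, ∀ u ∈ X, flipAt i u ∈ Y := by
    intro i u hu
    simp only [hX, hY, Set.mem_toFinset] at hu ⊢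
    exact hu _ (cubeAdj_flipAt i u)
  have hcount : ∀ i : Fin d, 2 * C ≤ ((X ∪ Y).filter fun u => flipAt i u ∈ X ∪ Y).card := by
    intro i
    have hsub : X ∪ X.image (flipAt i) ⊆ (X ∪ Y).filter fun u => flipAt i u ∈ X ∪ Y := by
      intro u hu
      rw [Finset.mem_union, Finset.mem_image] at hu
      simp only [Finset.mem_filter, Finset.mem_union]
      rcases hu with hu | ⟨w, hw, rfl⟩
      · exact ⟨Or.inl hu, Or.inr (hflip i u hu)⟩
      · rw [flipAt_flipAt]
        exact ⟨Or.inr (hflip i w hw), Or.inl hw⟩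
    have hdis : Disjoint X (X.image (flipAt i)) := by
      refine hdisj.mono_right fun u hu => ?_
      obtain ⟨w, hw, rfl⟩ := Finset.mem_image.1 hu
      exact hflip i w hw
    refine le_trans (le_of_eq ?_) (Finset.card_le_card hsub)
    rw [Finset.card_union_of_disjoint hdis,
      Finset.card_image_of_injective _ (flipAt_injective i), hXC]
    ring
  have h := sum_card_flipAt_le Finset.univ (X ∪ Y)
  have hsum : d * (2 * C)
      ≤ ∑ i : Fin d, ((X ∪ Y).filter fun u => flipAt i u ∈ X ∪ Y).card := by
    simpa using Finset.card_nsmul_le_sum Finset.univ _ _ fun i _ => hcount i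
  have hlog : 0 < Real.log 2 := Real.log_pos (by norm_num)
  rw [Real.logb, ← mul_div_assoc, le_div_iff₀ hlog]
  have hm : ((X ∪ Y).card : ℝ) = C + G := by
    rw [Finset.card_union_of_disjoint hdisj, hXC, hYG]
    push_cast
    ring
  rw [hm] at h
  refine le_trans (mul_le_mul_of_nonneg_right ?_ hlog.le) h
  calc 2 * (d : ℝ) * C = ((d * (2 * C) : ℕ) : ℝ) := by
        push_cast
        ring
    _ ≤ _ := by exact_mod_cast hsum

lemma ncard_Icc_set_le {V : Type*} [Finite V] {P S : Set V} (h : P ⊆ S) :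
    ((Set.Icc P S).ncard : ℝ) ≤ 2 ^ ((S.ncard : ℝ) - P.ncard) := by
  have hsub : Set.Icc P S ⊆ (fun D => P ∪ D) '' (𝒫 (S \ P)) := by
    rintro A ⟨hPA, hAS⟩
    exact ⟨A \ P, Set.sdiff_subset_sdiff_left hAS, Set.union_sdiff_cancel hPA⟩
  have h1 : (Set.Icc P S).ncard ≤ 2 ^ (S \ P).ncard := by
    rw [← Set.ncard_powerset _ (Set.toFinite _)]
    exact (Set.ncard_le_ncard hsub (Set.toFinite _)).trans (Set.ncard_image_le (Set.toFinite _))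
  have h2 : (S.ncard : ℝ) - P.ncard = (S \ P).ncard := by
    rw [Set.ncard_sdiff h (Set.toFinite _),
      Nat.cast_sub (Set.ncard_le_ncard h (Set.toFinite _))]
  rw [h2, Real.rpow_natCast]
  exact_mod_cast h1

lemma card_filter_card_le {V : Type*} [DecidableEq V] (T : Finset V) {k x : ℝ} (hx : 0 < x)
    (hx1 : x ≤ 1) :
    ((T.powerset.filter fun D => (D.card : ℝ) ≤ k).card : ℝ) * x ^ k
      ≤ Real.exp (x * T.card) := by
  calc _ ≤ ∑ D ∈ T.powerset.filter (fun D => (D.card : ℝ) ≤ k), x ^ D.card := by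
        rw [← nsmul_eq_mul]
        refine Finset.card_nsmul_le_sum _ _ _ fun D hD => ?_
        rw [← Real.rpow_natCast]
        exact Real.rpow_le_rpow_of_exponent_ge hx hx1 (Finset.mem_filter.1 hD).2
    _ ≤ ∑ D ∈ T.powerset, x ^ D.card :=
        Finset.sum_le_sum_of_subset_of_nonneg (Finset.filter_subset _ _)
          fun _ _ _ => by positivity
    _ = (x + 1) ^ T.card := by
        rw [← Finset.sum_pow_mul_eq_add_pow]
        simp
    _ ≤ Real.exp x ^ T.card :=
        pow_le_pow_left₀ (by positivity) (Real.add_one_le_exp x) _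
    _ = _ := by rw [← Real.exp_nat_mul, mul_comm]

/-- A set of at most `2dg` points has few subsets of size at most `c g / log₂ d`. -/
lemma card_filter_card_le_rpow {V : Type*} [DecidableEq V] (T : Finset V) {d g c : ℝ}
    (hd : 2 ≤ d) (hg : 0 ≤ g) (hT : (T.card : ℝ) ≤ 2 * d * g) :
    ((T.powerset.filter fun D => (D.card : ℝ) ≤ c * g / Real.logb 2 d).card : ℝ)
      ≤ 2 ^ (2 * c * g + 4 * g / d) := by
  have hd0 : 0 < d := by linarith
  have hL : 0 < Real.logb 2 d := Real.logb_pos (by norm_num) (by linarith)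
  have hdL : (2 : ℝ) ^ Real.logb 2 d = d := Real.rpow_logb (by norm_num) (by norm_num) hd0
  have h := card_filter_card_le T (k := c * g / Real.logb 2 d) (x := (d ^ 2)⁻¹)
    (by positivity) (inv_le_one_of_one_le₀ (by nlinarith))
  have hx : (d ^ 2)⁻¹ ^ (c * g / Real.logb 2 d) = (2 : ℝ) ^ (-(2 * c * g)) := by
    have : (d ^ 2)⁻¹ = (2 : ℝ) ^ (Real.logb 2 d * (-2)) := by
      rw [Real.rpow_mul (by norm_num), hdL, Real.rpow_neg hd0.le]
      norm_cast
    rw [this, ← Real.rpow_mul (by norm_num)]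
    congr 1
    field_simp
  rw [hx, Real.rpow_neg (by norm_num), ← div_eq_mul_inv, div_le_iff₀ (by positivity)] at h
  refine h.trans ?_
  rw [add_comm, Real.rpow_add (by norm_num)]
  refine mul_le_mul_of_nonneg_right ?_ (by positivity)
  rw [Real.rpow_def_of_pos (by norm_num)]
  refine Real.exp_le_exp.2 ?_
  have h1 : (d ^ 2)⁻¹ * T.card ≤ 2 * g / d := by
    calc _ ≤ (d ^ 2)⁻¹ * (2 * d * g) := by gcongr
      _ = _ := by field_simp
  have h2 : 0 ≤ 2 * g / d := by positivity
  have h3 := Real.log_two_gt_d9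
  have h4 : 4 * g / d = 2 * (2 * g / d) := by ring
  rw [h4]
  nlinarith

lemma eventually_cube_bounds {η : ℝ} (hη : 0 < η) :
    ∃ d₀ : ℕ, ∀ d : ℕ, d₀ ≤ d → 4 ≤ d ∧ 1 + Real.logb 2 d ≤ η * d ∧
      Real.logb 2 d ≤ η * Real.sqrt d ∧ 1 ≤ η * d := by
  have hlog : 0 < Real.log 2 := Real.log_pos (by norm_num)
  have h1 := (Real.isLittleO_log_id_atTop.comp_tendsto tendsto_natCast_atTop_atTop).def
    (c := η * Real.log 2 / 2) (by positivity)
  have h2 := ((isLittleO_log_rpow_atTop (r := 1 / 2) (by norm_num)).comp_tendsto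
    tendsto_natCast_atTop_atTop).def (c := η * Real.log 2) (by positivity)
  have h3 := tendsto_natCast_atTop_atTop (R := ℝ) |>.eventually_ge_atTop (2 / η)
  obtain ⟨d₀, h⟩ := Filter.eventually_atTop.1
    (h1.and (h2.and (h3.and (Filter.eventually_ge_atTop 4))))
  refine ⟨d₀, fun d hd => ?_⟩
  obtain ⟨h1, h2, h3, h4⟩ := h d hd
  simp only [Function.comp_apply, id_eq, Real.norm_eq_abs, Nat.abs_cast,
    abs_of_nonneg (Real.log_natCast_nonneg d)] at h1 h2
  rw [← Real.sqrt_eq_rpow, abs_of_nonneg (Real.sqrt_nonneg _)] at h2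
  rw [div_le_iff₀ hη] at h3
  refine ⟨h4, ?_, ?_, by linarith⟩
  · have : Real.logb 2 d ≤ η * d / 2 := by
      rw [Real.logb, div_le_iff₀ hlog]
      linarith
    linarith
  · rw [Real.logb, div_le_iff₀ hlog]
    linarith

/-- Small even sets expand: if `|A| ≤ α ^ d` with `α < 2`, then the closure of `A` is smaller
than `N(A)` by a constant factor. -/
lemma ncard_bset_nbhd_le {d : ℕ} (hd : 0 < d) {α : ℝ} (hα : 0 < α)
    (hlarge : 1 + Real.logb 2 d ≤ (1 - Real.logb 2 α) / 2 * d) {A : Set (Fin d → Bool)}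
    (hA : A ⊆ evenV d) (ha : (A.ncard : ℝ) ≤ α ^ d) :
    ((bset d (nbhd d A)).ncard : ℝ)
      ≤ (1 - (1 - Real.logb 2 α) / 2) * (nbhd d A).ncard := by
  set C := (bset d (nbhd d A)).ncard with hC
  set g := (nbhd d A).ncard with hG
  have hCg : C ≤ g := ncard_bset_le hd _
  have hCg' : (C : ℝ) ≤ g := by exact_mod_cast hCg
  rcases Nat.eq_zero_or_pos g with hg | hg
  · have : C = 0 := by omega
    simp [this, hg]
  have hg' : (0 : ℝ) < g := by exact_mod_cast hg
  have hd' : (0 : ℝ) < d := by exact_mod_cast hd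
  have hga : (g : ℝ) ≤ d * α ^ d :=
    (ncard_nbhd_le A).trans (mul_le_mul_of_nonneg_left ha hd'.le)
  have h := two_mul_ncard_bset_nbhd_le hd hA hC.symm hG.symm
  have hC0 : (0 : ℝ) ≤ C := Nat.cast_nonneg _
  have hlog : Real.logb 2 ((C : ℝ) + g) ≤ 1 + Real.logb 2 d + d * Real.logb 2 α := by
    calc _ ≤ Real.logb 2 (2 * (d * α ^ d)) :=
          Real.logb_le_logb_of_le (by norm_num) (by positivity) (by linarith)
      _ = _ := by
          rw [Real.logb_mul (by norm_num) (by positivity),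
            Real.logb_mul (by positivity) (by positivity), Real.logb_pow,
            Real.logb_self_eq_one (by norm_num)]
          ring
  set μ := 1 - (1 - Real.logb 2 α) / 2 with hμ
  have hlog' : Real.logb 2 ((C : ℝ) + g) ≤ μ * d := by
    rw [hμ]
    linarith
  have h2 : (2 * (C : ℝ)) * d ≤ ((C + g) * μ) * d := by
    have := mul_le_mul_of_nonneg_left hlog' (show (0 : ℝ) ≤ C + g by positivity)
    linarith
  have h3 := le_of_mul_le_mul_right h2 hd'
  by_contra! hlt
  nlinarith

open Classical in
/-- A family of even sets whose neighbourhoods exceed `F` by few elements and whose interiors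
`B(A)` omit few elements of `Q` is covered by few intervals `[N(B(A)), B(N(A))]`. -/
lemma card_family_le {d : ℕ} (𝒜 : Finset (Set (Fin d → Bool))) (F S Q : Set (Fin d → Bool))
    {k₁ k₂ N₁ N₂ M : ℝ} (hN₁ : 0 ≤ N₁) (hM : 0 ≤ M)
    (hF : ∀ A ∈ 𝒜, F ⊆ nbhd d A) (hS : ∀ A ∈ 𝒜, A ⊆ S) (hQ : ∀ A ∈ 𝒜, bset d A ⊆ Q)
    (h₁ : ∀ A ∈ 𝒜, ((nbhd d A \ F).ncard : ℝ) ≤ k₁)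
    (h₂ : ∀ A ∈ 𝒜, ((Q \ bset d A).ncard : ℝ) ≤ k₂)
    (hN₁' : (((nbhd d S).toFinset.powerset.filter
      fun D => (D.card : ℝ) ≤ k₁).card : ℝ) ≤ N₁)
    (hN₂' : ((Q.toFinset.powerset.filter fun D => (D.card : ℝ) ≤ k₂).card : ℝ) ≤ N₂)
    (hI : ∀ A ∈ 𝒜, (2 : ℝ) ^ (((bset d (nbhd d A)).ncard : ℝ) - (nbhd d (bset d A)).ncard)
      ≤ M) :
    (𝒜.card : ℝ) ≤ M * (N₁ * N₂) := by
  set φ : Set (Fin d → Bool) → Finset (Fin d → Bool) × Finset (Fin d → Bool) :=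
    fun A => ((nbhd d A \ F).toFinset, (Q \ bset d A).toFinset) with hφ
  have hfib : ∀ D ∈ 𝒜.image φ, (𝒜.filter fun A => φ A = D).card ≤ ⌊M⌋₊ := by
    intro D hD
    obtain ⟨A₀, hA₀, rfl⟩ := Finset.mem_image.1 hD
    have hsub : ((𝒜.filter fun A => φ A = φ A₀ : Finset (Set (Fin d → Bool))) :
        Set (Set (Fin d → Bool))) ⊆ Set.Icc (nbhd d (bset d A₀)) (bset d (nbhd d A₀)) := by
      intro A hA
      simp only [Finset.coe_filter, Set.mem_ofPred_eq, hφ, Prod.mk.injEq,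
        Set.toFinset_inj] at hA
      obtain ⟨hA, hN, hB⟩ := hA
      have hN' : nbhd d A = nbhd d A₀ := by
        rw [← Set.union_sdiff_cancel (hF A hA), hN, Set.union_sdiff_cancel (hF A₀ hA₀)]
      have hB' : bset d A = bset d A₀ := by
        rw [← Set.sdiff_sdiff_cancel_left (hQ A hA), hB,
          Set.sdiff_sdiff_cancel_left (hQ A₀ hA₀)]
      rw [← hN', ← hB']
      exact ⟨nbhd_bset_subset A, subset_bset_nbhd A⟩
    refine Nat.le_floor ?_
    rw [← Set.ncard_coe_finset]
    calc _ ≤ ((Set.Icc (nbhd d (bset d A₀)) (bset d (nbhd d A₀))).ncard : ℝ) := by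
          exact_mod_cast Set.ncard_le_ncard hsub (Set.toFinite _)
      _ ≤ _ := ncard_Icc_set_le ((nbhd_bset_subset A₀).trans (subset_bset_nbhd A₀))
      _ ≤ M := hI A₀ hA₀
  have himg : 𝒜.image φ ⊆
      ((nbhd d S).toFinset.powerset.filter fun D => (D.card : ℝ) ≤ k₁) ×ˢ
        (Q.toFinset.powerset.filter fun D => (D.card : ℝ) ≤ k₂) := by
    intro D hD
    obtain ⟨A, hA, rfl⟩ := Finset.mem_image.1 hD
    have hNS : nbhd d A ⊆ nbhd d S := fun v ⟨u, hu, huv⟩ => ⟨u, hS A hA hu, huv⟩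
    simp only [hφ, Finset.mem_product, Finset.mem_filter, Finset.mem_powerset,
      ← Set.ncard_eq_toFinset_card']
    refine ⟨⟨?_, h₁ A hA⟩, ?_, h₂ A hA⟩
    · exact Set.toFinset_subset_toFinset.2 (Set.sdiff_subset.trans hNS)
    · exact Set.toFinset_subset_toFinset.2 Set.sdiff_subset
  have h := Finset.card_le_mul_card_image 𝒜 ⌊M⌋₊ hfib
  have hprod := Finset.card_le_card himg
  rw [Finset.card_product] at hprod
  calc (𝒜.card : ℝ) ≤ (⌊M⌋₊ : ℝ) * (𝒜.image φ).card := by exact_mod_cast h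
    _ ≤ M * (N₁ * N₂) := by
      refine mul_le_mul (Nat.floor_le hM) ?_ (Nat.cast_nonneg _) hM
      refine (Nat.cast_le.2 hprod).trans ?_
      rw [Nat.cast_mul]
      exact mul_le_mul hN₁' hN₂' (Nat.cast_nonneg _) hN₁

/-- If every vertex of `S` has more than `d - √d` neighbours in `F`, then `S` is hardly larger
than `F`. -/
lemma ncard_le_of_ndeg {d : ℕ} (hd : 4 ≤ d) {S F : Set (Fin d → Bool)} {n : ℝ}
    (hF : (F.ncard : ℝ) ≤ n)
    (h : ∀ u ∈ S, (d : ℝ) - Real.sqrt d < ndeg d u F) :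
    (S.ncard : ℝ) ≤ F.ncard + 2 * n / Real.sqrt d := by
  have hd' : (4 : ℝ) ≤ d := by exact_mod_cast hd
  have hs : 2 ≤ Real.sqrt d := Real.le_sqrt_of_sq_le (by linarith)
  have hm := mul_ncard_le fun u hu => (h u hu).le
  set s := Real.sqrt d with hs'
  have hsd : (d : ℝ) = s * s := (Real.mul_self_sqrt (by linarith)).symm
  have hs0 : 0 < s := by linarith
  rw [hsd] at hm
  have hm' : (s - 1) * S.ncard ≤ s * F.ncard := by
    refine le_of_mul_le_mul_left ?_ hs0
    linarith
  have h2 : (S.ncard : ℝ) ≤ 2 * n := by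
    have : (S.ncard : ℝ) * (s / 2) ≤ F.ncard * s := by
      nlinarith [Nat.cast_nonneg (α := ℝ) S.ncard]
    nlinarith
  rw [← sub_le_iff_le_add', le_div_iff₀ hs0]
  linarith

theorem reconstruction (α : ℝ) (hα1 : 1 < α) (hα2 : α < 2) :
    ∃ ε > (0:ℝ), ∃ d₀ : ℕ, ∀ d : ℕ, d₀ ≤ d →
      ∀ a g b h : ℕ, (a:ℝ) ≤ α ^ d →
      ∀ F S P Q : Set (Fin d → Bool),
        F ⊆ oddV d → Q ⊆ oddV d → S ⊆ evenV d → P ⊆ evenV d →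
        (∀ u ∈ S, (d:ℝ) - Real.sqrt d < ndeg d u F) →
        (∀ v ∈ oddV d \ F, (d:ℝ) - Real.sqrt d < ndeg d v (evenV d \ S)) →
        (∀ u ∈ Q, (d:ℝ) - Real.sqrt d < ndeg d u P) →
        (∀ v ∈ evenV d \ P, (d:ℝ) - Real.sqrt d < ndeg d v (oddV d \ Q)) →
        (({A ∈ Hfam d a g b h |
            F ⊆ nbhd d A ∧ A ⊆ S ∧ P ⊆ nbhd d (bset d A) ∧ bset d A ⊆ Q} : Set _).ncard : ℝ)
          ≤ (2:ℝ) ^ ((g:ℝ) - b - ε * g / Real.logb 2 d) := by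
  classical
  have hlam : Real.logb 2 α < 1 := by
    rw [Real.logb_lt_iff_lt_rpow (by norm_num) (by linarith)]
    simpa using hα2
  set δ := (1 - Real.logb 2 α) / 2 with hδ
  have hδ0 : 0 < δ := by linarith
  obtain ⟨d₀, hd₀⟩ := eventually_cube_bounds (η := δ / 128) (by positivity)
  refine ⟨δ / 32, by positivity, d₀, ?_⟩
  intro d hd a g b h ha F S P Q _ _ _ _ hSF _ hQP _
  obtain ⟨hd4, hlog, hsqrt, hdδ⟩ := hd₀ d hd
  have hdpos : 0 < d := by omega
  have hd4' : (4 : ℝ) ≤ d := by exact_mod_cast hd4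
  set L := Real.logb 2 d with hL
  have hL1 : 1 ≤ L := by
    rw [hL, Real.le_logb_iff_rpow_le (by norm_num) (by linarith)]
    norm_num
    linarith
  set 𝒜 : Set (Set (Fin d → Bool)) := {A ∈ Hfam d a g b h |
    F ⊆ nbhd d A ∧ A ⊆ S ∧ P ⊆ nbhd d (bset d A) ∧ bset d A ⊆ Q} with h𝒜
  rcases Set.eq_empty_or_nonempty 𝒜 with hempty | ⟨A₀, hA₀⟩
  · rw [hempty, Set.ncard_empty, Nat.cast_zero]
    positivity
  have hS0 : 0 < Real.sqrt d := Real.sqrt_pos.2 (by linarith)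
  have hg0 : (0 : ℝ) ≤ g := Nat.cast_nonneg _
  -- sizes of the approximating sets
  obtain ⟨⟨-, -, haA, hgA, hbA, hhA⟩, hFA, hAS, hPA, hBQ⟩ := id hA₀
  have hPS : P ⊆ S := hPA.trans ((nbhd_bset_subset A₀).trans hAS)
  have hFg : (F.ncard : ℝ) ≤ g := by
    rw [← hgA]
    exact_mod_cast Set.ncard_le_ncard hFA (Set.toFinite _)
  have hbQ : (b : ℝ) ≤ Q.ncard := by
    rw [← hbA]
    exact_mod_cast Set.ncard_le_ncard hBQ (Set.toFinite _)
  have hPg : (P.ncard : ℝ) ≤ g := by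
    rw [← hgA]
    exact_mod_cast (Set.ncard_le_ncard (hPA.trans (nbhd_bset_subset A₀)) (Set.toFinite _)).trans
      (ncard_le_ncard_nbhd hdpos A₀)
  have hbh : (b : ℝ) ≤ h := by
    rw [← hbA, ← hhA]
    exact_mod_cast ncard_le_ncard_nbhd hdpos (bset d A₀)
  have hSn := ncard_le_of_ndeg hd4 hFg hSF
  have hQn := ncard_le_of_ndeg hd4 hPg hQP
  have herr : 2 * (g : ℝ) / Real.sqrt d ≤ δ / 64 * g / L := by
    rw [div_le_div_iff₀ hS0 (by linarith)]
    nlinarith [mul_le_mul_of_nonneg_left hsqrt hg0]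
  by_cases hcase : (F.ncard : ℝ) ≤ g - δ / 16 * g / L ∨ b + δ / 16 * g / L ≤ Q.ncard
  · have hsub : 𝒜 ⊆ Set.Icc P S := fun A hA =>
      ⟨hA.2.2.2.1.trans (nbhd_bset_subset A), hA.2.2.1⟩
    calc (𝒜.ncard : ℝ) ≤ (Set.Icc P S).ncard := by
          exact_mod_cast Set.ncard_le_ncard hsub (Set.toFinite _)
      _ ≤ _ := ncard_Icc_set_le hPS
      _ ≤ _ := by
        refine Real.rpow_le_rpow_of_exponent_le (by norm_num) ?_
        have e1 : δ / 16 * g / L = 2 * (δ / 32 * g / L) := by ring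
        have e2 : δ / 64 * g / L = (δ / 32 * g / L) / 2 := by ring
        rw [e1] at hcase
        rw [e2] at herr
        rcases hcase with hc | hc <;> linarith
  · push Not at hcase
    obtain ⟨hcF, hcQ⟩ := hcase
    have hsg : 2 * (g : ℝ) / Real.sqrt d ≤ g := by
      rw [div_le_iff₀ hS0]
      have : 2 ≤ Real.sqrt d := Real.le_sqrt_of_sq_le (by linarith)
      nlinarith
    have hN₁ := card_filter_card_le_rpow (nbhd d S).toFinset (d := d) (g := g) (c := δ / 16)
      (by linarith) hg0 (by
        rw [← Set.ncard_eq_toFinset_card']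
        refine (ncard_nbhd_le S).trans ?_
        have hS2 : (S.ncard : ℝ) ≤ 2 * g := by linarith
        linarith [mul_le_mul_of_nonneg_left hS2 (Nat.cast_nonneg (α := ℝ) d)])
    have hN₂ := card_filter_card_le_rpow Q.toFinset (d := d) (g := g) (c := δ / 16)
      (by linarith) hg0 (by
        rw [← Set.ncard_eq_toFinset_card']
        linarith [mul_le_mul_of_nonneg_right hd4' hg0])
    have hcard := card_family_le 𝒜.toFinset F S Q (k₁ := δ / 16 * g / L)
      (k₂ := δ / 16 * g / L) (M := (2 : ℝ) ^ ((1 - δ) * g - b)) (by positivity) (by positivity)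
      (fun A hA => (Set.mem_toFinset.1 hA).2.1) (fun A hA => (Set.mem_toFinset.1 hA).2.2.1)
      (fun A hA => (Set.mem_toFinset.1 hA).2.2.2.2)
      (fun A hA => by
        have hA := Set.mem_toFinset.1 hA
        have h1 : ((nbhd d A \ F).ncard : ℝ) + F.ncard = (nbhd d A).ncard := by
          exact_mod_cast Set.ncard_sdiff_add_ncard_of_subset hA.2.1 (Set.toFinite _)
        rw [hA.1.2.2.2.1] at h1
        linarith)
      (fun A hA => by
        have hA := Set.mem_toFinset.1 hA
        have h1 : ((Q \ bset d A).ncard : ℝ) + (bset d A).ncard = Q.ncard := by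
          exact_mod_cast Set.ncard_sdiff_add_ncard_of_subset hA.2.2.2.2 (Set.toFinite _)
        rw [hA.1.2.2.2.2.1] at h1
        linarith)
      hN₁ hN₂
      (fun A hA => by
        obtain ⟨⟨hev, -, haA, hgA, -, hhA⟩, -⟩ := Set.mem_toFinset.1 hA
        refine Real.rpow_le_rpow_of_exponent_le (by norm_num) ?_
        have hδd : δ / 128 * d ≤ δ * d := by gcongr; linarith
        have := ncard_bset_nbhd_le hdpos (by linarith) (hlog.trans hδd) hev
          (by rw [haA]; exact ha)
        rw [hgA, ← hδ] at this
        rw [hhA]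
        linarith)
    rw [Set.ncard_eq_toFinset_card']
    refine hcard.trans ?_
    rw [← Real.rpow_add (by norm_num), ← Real.rpow_add (by norm_num)]
    refine Real.rpow_le_rpow_of_exponent_le (by norm_num) ?_
    have h1 : 4 * (g : ℝ) / d ≤ δ / 32 * g := by
      rw [div_le_iff₀ (by linarith)]
      linarith [mul_le_mul_of_nonneg_left hdδ hg0]
    have h2 : δ / 32 * g / L ≤ δ / 32 * g := div_le_self (by positivity) hL1
    have h3 : 0 ≤ δ * g := by positivity
    linarith
end

section
/- There exist constants C > 0 and d₀ such that for all integers d ≥ d₀, every nonempty A ⊆ E, and every approximating quadruple (F,S,P,Q) for A: |S| ≤ |F| + C·|N(A)|/√d and |Q| ≤ |P| + C·|N(B(A))|/√d. -/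
/-- `(F, S, P, Q)` is an approximating quadruple for `A ⊆ E`. -/
def approxQuad (d : ℕ) (A F S P Q : Set (Fin d → Bool)) : Prop :=
  F ⊆ oddV d ∧ Q ⊆ oddV d ∧ S ⊆ evenV d ∧ P ⊆ evenV d ∧
  F ⊆ nbhd d A ∧ A ⊆ S ∧
  (∀ u ∈ S, (d:ℝ) - Real.sqrt d < ndeg d u F) ∧
  (∀ v ∈ oddV d \ F, (d:ℝ) - Real.sqrt d < ndeg d v (evenV d \ S)) ∧
  P ⊆ nbhd d (bset d A) ∧ bset d A ⊆ Q ∧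
  (∀ u ∈ Q, (d:ℝ) - Real.sqrt d < ndeg d u P) ∧
  (∀ v ∈ evenV d \ P, (d:ℝ) - Real.sqrt d < ndeg d v (oddV d \ Q))

/-- A vertex of the cube has at most `d` neighbours. -/
theorem card_filter_cubeAdj_le {d : ℕ} [DecidableRel (cubeAdj d)]
    (T : Finset (Fin d → Bool)) (v : Fin d → Bool) :
    (T.filter fun u => cubeAdj d u v).card ≤ d := by
  have h : (T.filter fun u => cubeAdj d u v) ⊆
      (Finset.univ : Finset (Fin d)).image fun i => Function.update v i (!v i) := by
    intro u hu
    obtain ⟨i, hi⟩ := Finset.card_eq_one.mp (Finset.mem_filter.mp hu).2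
    refine Finset.mem_image.mpr ⟨i, Finset.mem_univ i, ?_⟩
    funext j
    have hj : u j ≠ v j ↔ j = i := by
      simpa using congrArg (fun s => j ∈ s) hi
    by_cases hji : j = i
    · subst hji
      have := hj.mpr rfl
      simp only [Function.update_self]
      cases hu : u j <;> cases hv : v j <;> simp_all
    · rw [Function.update_of_ne hji]
      by_contra hne
      exact hji (hj.mp (Ne.symm hne))
  calc _ ≤ _ := Finset.card_le_card h
    _ ≤ (Finset.univ : Finset (Fin d)).card := Finset.card_image_le
    _ = d := by simp

/-- Double counting of the edges between `S` and `F`: if every vertex of `S` has at least `m`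
neighbours in `F`, then `|S| m ≤ |F| d`. -/
theorem ncard_mul_le_of_le_ndeg {d : ℕ} {S F : Set (Fin d → Bool)} {m : ℝ}
    (h : ∀ u ∈ S, m ≤ ndeg d u F) : (S.ncard : ℝ) * m ≤ F.ncard * d := by
  classical
  rw [Set.ncard_eq_toFinset_card' S, Set.ncard_eq_toFinset_card' F, ← nsmul_eq_mul,
    ← nsmul_eq_mul]
  refine Finset.card_nsmul_le_card_nsmul (cubeAdj d) (fun u hu => ?_) (fun v _ => ?_)
  · have hF : ({w ∈ F | cubeAdj d u w} : Set _) =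
        ((F.toFinset.bipartiteAbove (cubeAdj d) u : Finset _) : Set _) := by
      ext w
      simp [Finset.bipartiteAbove]
    have hd := h u (Set.mem_toFinset.mp hu)
    rwa [ndeg, hF, Set.ncard_coe_finset] at hd
  · exact_mod_cast card_filter_cubeAdj_le _ v

theorem ncard_le_add_of_sub_sqrt_lt_ndeg {d : ℕ} (hd : 4 ≤ d) {S F N : Set (Fin d → Bool)}
    (hFN : F ⊆ N) (h : ∀ u ∈ S, (d : ℝ) - Real.sqrt d < ndeg d u F) :
    (S.ncard : ℝ) ≤ F.ncard + 2 * N.ncard / Real.sqrt d := by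
  have hcount := ncard_mul_le_of_le_ndeg fun u hu => (h u hu).le
  have hN : (F.ncard : ℝ) ≤ N.ncard := by
    exact_mod_cast Set.ncard_le_ncard hFN (Set.toFinite N)
  have hr : (2 : ℝ) ≤ Real.sqrt d := by
    apply Real.le_sqrt_of_sq_le
    have : (4 : ℝ) ≤ d := by exact_mod_cast hd
    linarith
  have hsq : (d : ℝ) = Real.sqrt d * Real.sqrt d := (Real.mul_self_sqrt (by positivity)).symm
  generalize Real.sqrt d = r at *
  rw [hsq] at hcount
  have hF : (0 : ℝ) ≤ F.ncard := by positivity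
  have hmul : (S.ncard : ℝ) * (r - 1) ≤ F.ncard * r := by
    refine le_of_mul_le_mul_right ?_ (show 0 < r by linarith)
    linarith
  have hS : (S.ncard : ℝ) * r ≤ F.ncard * r + 2 * F.ncard := by
    refine le_of_mul_le_mul_right ?_ (show 0 < r - 1 by linarith)
    nlinarith [mul_le_mul_of_nonneg_right hmul (show 0 ≤ r by linarith),
      mul_nonneg hF (show 0 ≤ r - 2 by linarith)]
  have hr0 : 0 < r := by linarith
  rw [← sub_le_iff_le_add', le_div_iff₀ hr0]
  linarith

theorem approx_quadruple_size_bounds :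
    ∃ C > (0:ℝ), ∃ d₀ : ℕ, ∀ d : ℕ, d₀ ≤ d →
      ∀ A : Set (Fin d → Bool), A ⊆ evenV d → A.Nonempty →
        ∀ F S P Q : Set (Fin d → Bool), approxQuad d A F S P Q →
          (S.ncard : ℝ) ≤ F.ncard + C * (nbhd d A).ncard / Real.sqrt d ∧
          (Q.ncard : ℝ) ≤ P.ncard + C * (nbhd d (bset d A)).ncard / Real.sqrt d := by
  refine ⟨2, by norm_num, 4, fun d hd A _ _ F S P Q h => ?_⟩
  obtain ⟨-, -, -, -, hFN, -, hS, -, hPN, -, hQ, -⟩ := h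
  exact ⟨ncard_le_add_of_sub_sqrt_lt_ndeg hd hFN hS, ncard_le_add_of_sub_sqrt_lt_ndeg hd hPN hQ⟩
end
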